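/- With B, C and E a regular separability idempotent as in the context, there exist unique linear functionals φ_B : B → ℂ and φ_C : C → ℂ such that (φ_B ⊗ id_C)(E) = 1 in C and (id_B ⊗ φ_C)(E) = 1 in B. Moreover φ_B and φ_C are faithful: if b ∈ B satisfies φ_B(b b') = 0 for all b' ∈ B, or φ_B(b' b) = 0 for all b' ∈ B, then b = 0, and likewise for φ_C on C. -/

import Mathlib

open TensorProduct

/-- Slice map `id ⊗ ω` landing in the left tensor factor. -/
noncomputable def sL {B C : Type} [AddCommGroup B] [Module ℂ B] [AddCommGroup C] [Module ℂ C]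
    (ω : C →ₗ[ℂ] ℂ) : (B ⊗[ℂ] C) →ₗ[ℂ] B :=
  (TensorProduct.rid ℂ B).toLinearMap ∘ₗ LinearMap.lTensor B ω

/-- Slice map `ω ⊗ id` landing in the right tensor factor. -/
noncomputable def sR {B C : Type} [AddCommGroup B] [Module ℂ B] [AddCommGroup C] [Module ℂ C]
    (ω : B →ₗ[ℂ] ℂ) : (B ⊗[ℂ] C) →ₗ[ℂ] C :=
  (TensorProduct.lid ℂ C).toLinearMap ∘ₗ LinearMap.rTensor C ω

section Slices

variable {B C : Type}

section Modules

variable [AddCommGroup B] [Module ℂ B] [AddCommGroup C] [Module ℂ C]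

lemma sL_tmul (ω : C →ₗ[ℂ] ℂ) (b : B) (c : C) : sL ω (b ⊗ₜ[ℂ] c) = ω c • b := by
  simp [sL]

lemma sR_tmul (ω : B →ₗ[ℂ] ℂ) (b : B) (c : C) : sR ω (b ⊗ₜ[ℂ] c) = ω b • c := by
  simp [sR]

lemma apply_sL_eq_apply_sR (φ : B →ₗ[ℂ] ℂ) (ω : C →ₗ[ℂ] ℂ) (E : B ⊗[ℂ] C) :
    φ (sL ω E) = ω (sR φ E) := by
  induction E with
  | zero => simp
  | tmul b c => simp [sL_tmul, sR_tmul, mul_comm]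
  | add x y hx hy => simp [hx, hy]

lemma exists_sL_eq {E : B ⊗[ℂ] C}
    (h : Submodule.span ℂ {x : B | ∃ ω : C →ₗ[ℂ] ℂ, x = sL ω E} = ⊤) (b : B) :
    ∃ ω : C →ₗ[ℂ] ℂ, sL ω E = b := by
  have hb : b ∈ Submodule.span ℂ {x : B | ∃ ω : C →ₗ[ℂ] ℂ, x = sL ω E} := h ▸ trivial
  induction hb using Submodule.span_induction with
  | mem x hx => exact hx.imp fun _ hω => hω.symm
  | zero => exact ⟨0, by simp [sL]⟩
  | add x y _ _ hx hy =>
    obtain ⟨ω, rfl⟩ := hx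
    obtain ⟨ω', rfl⟩ := hy
    exact ⟨ω + ω', by simp [sL, LinearMap.lTensor_add]⟩
  | smul a x _ hx =>
    obtain ⟨ω, rfl⟩ := hx
    exact ⟨a • ω, by simp [sL, LinearMap.lTensor_smul]⟩

lemma exists_sR_eq {E : B ⊗[ℂ] C}
    (h : Submodule.span ℂ {y : C | ∃ ω : B →ₗ[ℂ] ℂ, y = sR ω E} = ⊤) (c : C) :
    ∃ ω : B →ₗ[ℂ] ℂ, sR ω E = c := by
  have hc : c ∈ Submodule.span ℂ {y : C | ∃ ω : B →ₗ[ℂ] ℂ, y = sR ω E} := h ▸ trivial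
  induction hc using Submodule.span_induction with
  | mem x hx => exact hx.imp fun _ hω => hω.symm
  | zero => exact ⟨0, by simp [sR]⟩
  | add x y _ _ hx hy =>
    obtain ⟨ω, rfl⟩ := hx
    obtain ⟨ω', rfl⟩ := hy
    exact ⟨ω + ω', by simp [sR, LinearMap.rTensor_add]⟩
  | smul a x _ hx =>
    obtain ⟨ω, rfl⟩ := hx
    exact ⟨a • ω, by simp [sR, LinearMap.rTensor_smul]⟩

end Modules

variable [Ring B] [Algebra ℂ B] [Ring C] [Algebra ℂ C]

lemma sR_mul_one_tmul (φ : B →ₗ[ℂ] ℂ) (E : B ⊗[ℂ] C) (c : C) :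
    sR φ (E * (1 ⊗ₜ[ℂ] c)) = sR φ E * c := by
  induction E with
  | zero => simp
  | tmul x y => simp [sR_tmul]
  | add x y hx hy => simp [add_mul, hx, hy]

lemma sR_one_tmul_mul (φ : B →ₗ[ℂ] ℂ) (E : B ⊗[ℂ] C) (c : C) :
    sR φ ((1 ⊗ₜ[ℂ] c) * E) = c * sR φ E := by
  induction E with
  | zero => simp
  | tmul x y => simp [sR_tmul]
  | add x y hx hy => simp [mul_add, hx, hy]

lemma sL_mul_tmul_one (φ : C →ₗ[ℂ] ℂ) (E : B ⊗[ℂ] C) (b : B) :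
    sL φ (E * (b ⊗ₜ[ℂ] 1)) = sL φ E * b := by
  induction E with
  | zero => simp
  | tmul x y => simp [sL_tmul]
  | add x y hx hy => simp [add_mul, hx, hy]

lemma sL_tmul_one_mul (φ : C →ₗ[ℂ] ℂ) (E : B ⊗[ℂ] C) (b : B) :
    sL φ ((b ⊗ₜ[ℂ] 1) * E) = b * sL φ E := by
  induction E with
  | zero => simp
  | tmul x y => simp [sL_tmul]
  | add x y hx hy => simp [mul_add, hx, hy]

lemma sR_mul_tmul_one_eq_zero {φ : B →ₗ[ℂ] ℂ} {b : B} (h : ∀ b', φ (b' * b) = 0)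
    (E : B ⊗[ℂ] C) : sR φ (E * (b ⊗ₜ[ℂ] 1)) = 0 := by
  induction E with
  | zero => simp
  | tmul x y => simp [sR_tmul, h]
  | add x y hx hy => simp [add_mul, hx, hy]

lemma sR_tmul_one_mul_eq_zero {φ : B →ₗ[ℂ] ℂ} {b : B} (h : ∀ b', φ (b * b') = 0)
    (E : B ⊗[ℂ] C) : sR φ ((b ⊗ₜ[ℂ] 1) * E) = 0 := by
  induction E with
  | zero => simp
  | tmul x y => simp [sR_tmul, h]
  | add x y hx hy => simp [mul_add, hx, hy]

lemma sL_mul_one_tmul_eq_zero {φ : C →ₗ[ℂ] ℂ} {c : C} (h : ∀ c', φ (c' * c) = 0)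
    (E : B ⊗[ℂ] C) : sL φ (E * (1 ⊗ₜ[ℂ] c)) = 0 := by
  induction E with
  | zero => simp
  | tmul x y => simp [sL_tmul, h]
  | add x y hx hy => simp [add_mul, hx, hy]

lemma sL_one_tmul_mul_eq_zero {φ : C →ₗ[ℂ] ℂ} {c : C} (h : ∀ c', φ (c * c') = 0)
    (E : B ⊗[ℂ] C) : sL φ ((1 ⊗ₜ[ℂ] c) * E) = 0 := by
  induction E with
  | zero => simp
  | tmul x y => simp [sL_tmul, h]
  | add x y hx hy => simp [mul_add, hx, hy]

end Slices

theorem statement3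
    (B C : Type) [Ring B] [Algebra ℂ B] [Ring C] [Algebra ℂ C]
    (E : B ⊗[ℂ] C) (hEE : E * E = E)
    (hfullB : Submodule.span ℂ {x : B | ∃ ω : C →ₗ[ℂ] ℂ, x = sL ω E} = ⊤)
    (hfullC : Submodule.span ℂ {y : C | ∃ ω : B →ₗ[ℂ] ℂ, y = sR ω E} = ⊤)
    (SB : B ≃ₗ[ℂ] C) (SC : C ≃ₗ[ℂ] B)
    (hSBanti : ∀ b b' : B, SB (b * b') = SB b' * SB b)
    (hSCanti : ∀ c c' : C, SC (c * c') = SC c' * SC c)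
    (hSBrel : ∀ b : B, E * (b ⊗ₜ[ℂ] (1 : C)) = E * ((1 : B) ⊗ₜ[ℂ] SB b))
    (hSCrel : ∀ c : C, ((1 : B) ⊗ₜ[ℂ] c) * E = (SC c ⊗ₜ[ℂ] (1 : C)) * E)
 :
    (∃! φB : B →ₗ[ℂ] ℂ, sR φB E = (1 : C)) ∧
    (∃! φC : C →ₗ[ℂ] ℂ, sL φC E = (1 : B)) ∧
    (∀ φB : B →ₗ[ℂ] ℂ, sR φB E = (1 : C) →
      ∀ b : B, ((∀ b' : B, φB (b * b') = 0) → b = 0) ∧ ((∀ b' : B, φB (b' * b) = 0) → b = 0)) ∧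
    (∀ φC : C →ₗ[ℂ] ℂ, sL φC E = (1 : B) →
      ∀ c : C, ((∀ c' : C, φC (c * c') = 0) → c = 0) ∧ ((∀ c' : C, φC (c' * c) = 0) → c = 0)) := by
  refine ⟨?_, ?_, fun φ hφ b => ⟨fun h => ?_, fun h => ?_⟩,
    fun φ hφ c => ⟨fun h => ?_, fun h => ?_⟩⟩
  · obtain ⟨φ, hφ⟩ := exists_sR_eq hfullC 1
    refine ⟨φ, hφ, fun ψ hψ => LinearMap.ext fun b => ?_⟩
    obtain ⟨ω, rfl⟩ := exists_sL_eq hfullB b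
    rw [apply_sL_eq_apply_sR, apply_sL_eq_apply_sR, hφ, hψ]
  · obtain ⟨φ, hφ⟩ := exists_sL_eq hfullB 1
    refine ⟨φ, hφ, fun ψ hψ => LinearMap.ext fun c => ?_⟩
    obtain ⟨ω, rfl⟩ := exists_sR_eq hfullC c
    rw [← apply_sL_eq_apply_sR, ← apply_sL_eq_apply_sR, hφ, hψ]
  · obtain ⟨c, rfl⟩ := SC.surjective b
    have key := sR_tmul_one_mul_eq_zero h E
    rw [← hSCrel, sR_one_tmul_mul, hφ, mul_one] at key
    rw [key, map_zero]
  · have key := sR_mul_tmul_one_eq_zero h E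
    rw [hSBrel, sR_mul_one_tmul, hφ, one_mul] at key
    exact SB.map_eq_zero_iff.mp key
  · have key := sL_one_tmul_mul_eq_zero h E
    rw [hSCrel, sL_tmul_one_mul, hφ, mul_one] at key
    exact SC.map_eq_zero_iff.mp key
  · obtain ⟨b, rfl⟩ := SB.surjective c
    have key := sL_mul_one_tmul_eq_zero h E
    rw [← hSBrel, sL_mul_tmul_one, hφ, one_mul] at key
    rw [key, map_zero]
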